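/- arXiv:2205.01146 — 5 statements merged into one kernel-verified Lean document; each statement's English description precedes it below -/
import Mathlib

section
/- Let T > 0 and C1, C2 > 0. Let H, h : [0,T] → ℝ be differentiable functions with H(t) > 0 and h(t) > 0 for all t ∈ [0,T], satisfying H'(t) ≥ C1·h(t)⁻¹ and h'(t) ≤ C2·H(t)⁻²·h(t) for all t ∈ [0,T]. Assume H(0)/h(0) > C2/C1, and set C3 := C1·h(0)⁻¹ − C2·H(0)⁻¹ (which is then positive). Then for all t ∈ [0,T]: H(t) ≥ C3·t + H(0), and h(t) ≤ h(0)·exp(C2/(C3·H(0))). -/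
theorem mono_aux (T : ℝ) (f f' : ℝ → ℝ)
    (hf : ∀ t ∈ Set.Icc (0:ℝ) T, HasDerivAt f (f' t) t)
    (h0 : ∀ t ∈ Set.Icc (0:ℝ) T, 0 ≤ f' t) :
    ∀ t ∈ Set.Icc (0:ℝ) T, f 0 ≤ f t := by
  intro t ht
  have hm : MonotoneOn f (Set.Icc (0:ℝ) T) := by
    apply monotoneOn_of_deriv_nonneg (convex_Icc 0 T)
    · exact fun x hx => (hf x hx).continuousAt.continuousWithinAt
    · exact fun x hx => (hf x (interior_subset hx)).differentiableAt.differentiableWithinAt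
    · intro x hx
      rw [(hf x (interior_subset hx)).deriv]
      exact h0 x (interior_subset hx)
  exact hm ⟨le_refl _, ht.1.trans ht.2⟩ ht ht.1

/-- The ODE Lemma: if `H' ≥ C1·h⁻¹` and `h' ≤ C2·H⁻²·h` on `[0,T]` with
`H(0)/h(0) > C2/C1`, then `H` grows at least linearly and `h` stays bounded. -/
theorem ode_lemma (T C1 C2 : ℝ) (hT : 0 < T) (hC1 : 0 < C1) (hC2 : 0 < C2)
    (H h H' h' : ℝ → ℝ)
    (hHderiv : ∀ t ∈ Set.Icc (0:ℝ) T, HasDerivAt H (H' t) t)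
    (hhderiv : ∀ t ∈ Set.Icc (0:ℝ) T, HasDerivAt h (h' t) t)
    (hHpos : ∀ t ∈ Set.Icc (0:ℝ) T, 0 < H t)
    (hhpos : ∀ t ∈ Set.Icc (0:ℝ) T, 0 < h t)
    (hH' : ∀ t ∈ Set.Icc (0:ℝ) T, C1 * (h t)⁻¹ ≤ H' t)
    (hh' : ∀ t ∈ Set.Icc (0:ℝ) T, h' t ≤ C2 * (H t ^ 2)⁻¹ * h t)
    (hinit : C2 / C1 < H 0 / h 0)
    (C3 : ℝ) (hC3 : C3 = C1 * (h 0)⁻¹ - C2 * (H 0)⁻¹) :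
    ∀ t ∈ Set.Icc (0:ℝ) T,
      C3 * t + H 0 ≤ H t ∧ h t ≤ h 0 * Real.exp (C2 / (C3 * H 0)) := by
  have m0 : (0:ℝ) ∈ Set.Icc (0:ℝ) T := ⟨le_refl _, hT.le⟩
  have hH0 := hHpos 0 m0
  have hh0 := hhpos 0 m0
  have hC3pos : 0 < C3 := by
    rw [div_lt_div_iff₀ hC1 hh0] at hinit
    have e : C3 = (H 0 * C1 - C2 * h 0) / (h 0 * H 0) := by
      rw [hC3]; field_simp
    rw [e]
    exact div_pos (by linarith) (by positivity)
  have hG := mono_aux T (fun t => C1 * (h t)⁻¹ - C2 * (H t)⁻¹)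
    (fun t => C1 * (-h' t / h t ^ 2) - C2 * (-H' t / H t ^ 2))
    (fun t ht => (((hhderiv t ht).inv (hhpos t ht).ne').const_mul C1).sub
      (((hHderiv t ht).inv (hHpos t ht).ne').const_mul C2))
    (by
      intro t ht
      have hp := hhpos t ht
      have Hp := hHpos t ht
      have e1 : h' t / h t ^ 2 ≤ C2 * (H t ^ 2)⁻¹ * h t / h t ^ 2 := by
        gcongr
        exact hh' t ht
      have e2 : C1 * (h t)⁻¹ / H t ^ 2 ≤ H' t / H t ^ 2 := by
        gcongr
        exact hH' t ht
      have e3 := mul_le_mul_of_nonneg_left e1 hC1.le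
      have e4 := mul_le_mul_of_nonneg_left e2 hC2.le
      have e5 : C1 * (C2 * (H t ^ 2)⁻¹ * h t / h t ^ 2) = C2 * (C1 * (h t)⁻¹ / H t ^ 2) := by
        field_simp
      simp only [neg_div]
      linarith)
  have hlin : ∀ t ∈ Set.Icc (0:ℝ) T, C3 * t + H 0 ≤ H t := by
    intro t ht
    have := mono_aux T (fun t => H t - C3 * t) (fun t => H' t - C3 * 1)
      (fun t ht => (hHderiv t ht).sub ((hasDerivAt_id t).const_mul C3))
      (by
        intro t ht
        have a := hG t ht
        have b := hH' t ht
        have c : 0 < C2 * (H t)⁻¹ := mul_pos hC2 (inv_pos.2 (hHpos t ht))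
        linarith) t ht
    linarith
  intro t ht
  refine ⟨hlin t ht, ?_⟩
  have hlp : ∀ t ∈ Set.Icc (0:ℝ) T, 0 < C3 * t + H 0 := by
    intro t ht
    have := mul_nonneg hC3pos.le ht.1
    linarith
  have key := mono_aux T (fun t => -(C2 / C3 * (C3 * t + H 0)⁻¹) - Real.log (h t))
    (fun t => -(C2 / C3 * (-(C3 * 1) / (C3 * t + H 0) ^ 2)) - h' t / h t)
    (fun t ht => (((((hasDerivAt_id t).const_mul C3).add_const (H 0)).inv
      (hlp t ht).ne').const_mul (C2 / C3)).neg.sub ((hhderiv t ht).log (hhpos t ht).ne'))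
    (by
      intro t ht
      have hp := hhpos t ht
      have Lp := hlp t ht
      have e1 : h' t / h t ≤ C2 * (H t ^ 2)⁻¹ := by
        rw [div_le_iff₀ hp]
        exact hh' t ht
      have e2 : C2 * (H t ^ 2)⁻¹ ≤ C2 * ((C3 * t + H 0) ^ 2)⁻¹ := by
        gcongr
        exact hlin t ht
      have e3 : -(C2 / C3 * (-(C3 * 1) / (C3 * t + H 0) ^ 2)) = C2 * ((C3 * t + H 0) ^ 2)⁻¹ := by
        field_simp
      simp only [e3]
      linarith) t ht
  have q : 0 < C2 / C3 * (C3 * t + H 0)⁻¹ := mul_pos (div_pos hC2 hC3pos) (inv_pos.2 (hlp t ht))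
  have r : C2 / C3 * (C3 * 0 + H 0)⁻¹ = C2 / (C3 * H 0) := by
    rw [mul_zero, zero_add]; field_simp
  simp only [r] at key
  rw [← Real.log_le_log_iff (hhpos t ht) (by positivity),
    Real.log_mul hh0.ne' (Real.exp_pos _).ne', Real.log_exp]
  linarith
end

section
/- Let C1, C2 > 0, h₀ > 0, T > 0, and let H₀ : [0,T] → ℝ be a differentiable function with H₀(t) > 0 for all t, satisfying H₀'(t) = (C1/h₀)·exp(−C2·∫₀ᵗ H₀(s)⁻² ds) for every t ∈ [0,T]. Then H₀'(t) − C2·H₀(t)⁻¹ = C1/h₀ − C2·H₀(0)⁻¹ for every t ∈ [0,T]. In particular, if C3 := C1/h₀ − C2·H₀(0)⁻¹ > 0, then H₀(t) ≥ C3·t + H₀(0) for all t ∈ [0,T]. -/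
/-- The comparison solution `H₀` of `H₀'(t) = (C1/h₀)·exp(−C2·∫₀ᵗ H₀⁻²)` has the
conserved quantity `H₀' − C2/H₀`, and hence grows at least linearly when
`C3 := C1/h₀ − C2·H₀(0)⁻¹ > 0`. -/
theorem ode_comparison (C1 C2 h₀ T : ℝ) (hC1 : 0 < C1) (hC2 : 0 < C2)
    (hh₀ : 0 < h₀) (hT : 0 < T)
    (H₀ : ℝ → ℝ)
    (hpos : ∀ t ∈ Set.Icc (0:ℝ) T, 0 < H₀ t)
    (hderiv : ∀ t ∈ Set.Icc (0:ℝ) T,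
      HasDerivAt H₀ ((C1 / h₀) * Real.exp (-C2 * ∫ s in (0:ℝ)..t, (H₀ s ^ 2)⁻¹)) t) :
    (∀ t ∈ Set.Icc (0:ℝ) T,
      (C1 / h₀) * Real.exp (-C2 * ∫ s in (0:ℝ)..t, (H₀ s ^ 2)⁻¹) - C2 * (H₀ t)⁻¹
        = C1 / h₀ - C2 * (H₀ 0)⁻¹) ∧
    (0 < C1 / h₀ - C2 * (H₀ 0)⁻¹ →
      ∀ t ∈ Set.Icc (0:ℝ) T, (C1 / h₀ - C2 * (H₀ 0)⁻¹) * t + H₀ 0 ≤ H₀ t) := by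
  have hcont : ContinuousOn (fun s => (H₀ s ^ 2)⁻¹) (Set.Icc 0 T) := by
    apply ContinuousOn.inv₀
    · exact ContinuousOn.pow (fun t ht => (hderiv t ht).continuousAt.continuousWithinAt) 2
    · intro t ht
      exact (pow_pos (hpos t ht) 2).ne'
  obtain ⟨g, hg, hgeq⟩ : ∃ g : ℝ → ℝ, Continuous g ∧
      ∀ s ∈ Set.Icc (0:ℝ) T, g s = (H₀ s ^ 2)⁻¹ := by
    refine ⟨Set.IccExtend hT.le ((Set.Icc (0:ℝ) T).restrict (fun s => (H₀ s ^ 2)⁻¹)),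
      (continuousOn_iff_continuous_restrict.1 hcont).Icc_extend', ?_⟩
    intro s hs
    rw [Set.IccExtend_of_mem hT.le _ hs]
    rfl
  have hI : ∀ t ∈ Set.Icc (0:ℝ) T,
      (∫ s in (0:ℝ)..t, (H₀ s ^ 2)⁻¹) = ∫ s in (0:ℝ)..t, g s := by
    intro t ht
    apply intervalIntegral.integral_congr
    intro s hs
    rw [Set.uIcc_of_le ht.1] at hs
    exact (hgeq s ⟨hs.1, hs.2.trans ht.2⟩).symm
  have hK : ∀ t ∈ Set.Icc (0:ℝ) T, HasDerivAt
      (fun t => (C1 / h₀) * Real.exp (-C2 * ∫ s in (0:ℝ)..t, g s) - C2 * (H₀ t)⁻¹) 0 t := by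
    intro t ht
    have h1 : HasDerivAt (fun t => ∫ s in (0:ℝ)..t, g s) (g t) t :=
      hg.integral_hasStrictDerivAt 0 t |>.hasDerivAt
    have h2 := ((h1.const_mul (-C2)).exp.const_mul (C1 / h₀)).sub
      (((hderiv t ht).fun_inv (hpos t ht).ne').const_mul C2)
    refine h2.congr_deriv ?_
    rw [hI t ht, hgeq t ht]
    have := (hpos t ht).ne'
    field_simp
    ring
  have main : ∀ t ∈ Set.Icc (0:ℝ) T,
      (C1 / h₀) * Real.exp (-C2 * ∫ s in (0:ℝ)..t, (H₀ s ^ 2)⁻¹) - C2 * (H₀ t)⁻¹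
        = C1 / h₀ - C2 * (H₀ 0)⁻¹ := by
    intro t ht
    have := constant_of_has_deriv_right_zero
      (fun t ht => (hK t ht).continuousAt.continuousWithinAt)
      (fun t ht => (hK t (Set.Ico_subset_Icc_self ht)).hasDerivWithinAt) t ht
    rw [hI t ht]
    simpa using this
  refine ⟨main, fun _ t ht => ?_⟩
  have hL : ∀ t ∈ Set.Icc (0:ℝ) T, HasDerivAt
      (fun t => H₀ t - (C1 / h₀ - C2 * (H₀ 0)⁻¹) * t) (C2 * (H₀ t)⁻¹) t := by
    intro t ht
    refine ((hderiv t ht).sub ((hasDerivAt_id' t).const_mul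
      (C1 / h₀ - C2 * (H₀ 0)⁻¹))).congr_deriv ?_
    linarith [main t ht]
  have hmono : MonotoneOn (fun t => H₀ t - (C1 / h₀ - C2 * (H₀ 0)⁻¹) * t) (Set.Icc 0 T) := by
    apply monotoneOn_of_deriv_nonneg (convex_Icc 0 T)
    · exact fun t ht => (hL t ht).continuousAt.continuousWithinAt
    · exact fun t ht => (hL t (interior_subset ht)).differentiableAt.differentiableWithinAt
    · intro t ht
      rw [(hL t (interior_subset ht)).deriv]
      exact mul_nonneg hC2.le (inv_nonneg.2 (hpos t (interior_subset ht)).le)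
  have := hmono ⟨le_rfl, hT.le⟩ ht ht.1
  simp only [mul_zero] at this
  linarith
end

section
/- Let n ≥ 1 and let k : Fin n → Fin n → ℝ satisfy k i j = k j i for all i, j, k i j ≥ 0 for all i, j, and k i i = 0 for all i. Define λ i := Σ_{j} k i j. Then for every index i: 2·λ i ≤ Σ_{j} λ j. -/
/-- Algebraic content of `Ric ≤ ½·R·g` under nonnegative curvature operator:
if `k` is symmetric, nonnegative, with vanishing diagonal, and `λ i = ∑ j, k i j`,
then `2·λ i ≤ ∑ j, λ j` for every `i`. -/
theorem ricci_half_scalar (n : ℕ) (hn : 1 ≤ n) (k : Fin n → Fin n → ℝ)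
    (hsymm : ∀ i j, k i j = k j i)
    (hnonneg : ∀ i j, 0 ≤ k i j)
    (hdiag : ∀ i, k i i = 0) :
    ∀ i : Fin n, 2 * (∑ j, k i j) ≤ ∑ i', ∑ j, k i' j := by
  intro i
  have h1 := Finset.add_sum_erase Finset.univ (fun i' => ∑ j, k i' j) (Finset.mem_univ i)
  have h2 := Finset.add_sum_erase Finset.univ (fun j => k i j) (Finset.mem_univ i)
  have h3 : ∑ j ∈ Finset.univ.erase i, k i j ≤ ∑ i' ∈ Finset.univ.erase i, ∑ j, k i' j := by
    apply Finset.sum_le_sum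
    intro j _
    rw [hsymm i j]
    exact Finset.single_le_sum (f := fun l => k j l) (fun l _ => hnonneg j l) (Finset.mem_univ i)
  have h4 := hdiag i
  linarith
end

section
/- For every α ≥ 0 and all x, y ∈ ℝ: exp(α·√(x²+y²)) ≤ (1/0.8)·∫₀^{2π} exp(1.1·α·(x·cos θ + y·sin θ)) dθ. -/
open Real in
/-- The averaging inequality:
`exp(α·√(x²+y²)) ≤ (1/0.8)·∫₀^{2π} exp(1.1·α·(x·cos θ + y·sin θ)) dθ` for `α ≥ 0`. -/
theorem averaging_inequality (α x y : ℝ) (hα : 0 ≤ α) :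
    Real.exp (α * Real.sqrt (x ^ 2 + y ^ 2))
      ≤ (1 / 0.8) * ∫ θ in (0:ℝ)..(2 * Real.pi),
          Real.exp (1.1 * α * (x * Real.cos θ + y * Real.sin θ)) := by
  obtain ⟨r, φ, hr, hx, hy⟩ : ∃ r φ : ℝ, 0 ≤ r ∧ x = r * Real.cos φ ∧ y = r * Real.sin φ :=
    ⟨‖(⟨x, y⟩ : ℂ)‖, Complex.arg ⟨x, y⟩, norm_nonneg _,
      (Complex.norm_mul_cos_arg ⟨x, y⟩).symm, (Complex.norm_mul_sin_arg ⟨x, y⟩).symm⟩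
  have hs : Real.sqrt (x ^ 2 + y ^ 2) = r := by
    have h : x ^ 2 + y ^ 2 = r ^ 2 := by
      rw [hx, hy]
      linear_combination r ^ 2 * Real.sin_sq_add_cos_sq φ
    rw [h, Real.sqrt_sq hr]
  rw [hs]
  set f : ℝ → ℝ := fun θ => Real.exp (1.1 * α * (x * Real.cos θ + y * Real.sin θ)) with hf
  have hc : Continuous f := by fun_prop
  have hper : Function.Periodic f (2 * Real.pi) := by
    intro θ
    simp [hf]
  have h1 : ∫ θ in (0:ℝ)..(2 * Real.pi), f θ
      = ∫ θ in (φ - 0.4)..(φ - 0.4 + 2 * Real.pi), f θ := by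
    have := hper.intervalIntegral_add_eq 0 (φ - 0.4)
    rwa [zero_add] at this
  have h2 : ∫ θ in (φ - 0.4)..(φ + 0.4), f θ
      ≤ ∫ θ in (φ - 0.4)..(φ - 0.4 + 2 * Real.pi), f θ := by
    apply intervalIntegral.integral_mono_interval le_rfl (by norm_num; linarith)
      (by linarith [Real.pi_gt_three])
    · exact Filter.Eventually.of_forall fun θ => (Real.exp_pos _).le
    · exact hc.intervalIntegrable _ _
  have h3 : ∫ θ in (φ - 0.4)..(φ + 0.4), Real.exp (α * r)
      ≤ ∫ θ in (φ - 0.4)..(φ + 0.4), f θ := by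
    apply intervalIntegral.integral_mono_on (by linarith) (by simp)
      (hc.intervalIntegrable _ _)
    intro θ hθ
    apply Real.exp_le_exp.mpr
    have e : x * Real.cos θ + y * Real.sin θ = r * Real.cos (θ - φ) := by
      rw [Real.cos_sub, hx, hy]; ring
    rw [e]
    have hcos : 1 ≤ 1.1 * Real.cos (θ - φ) := by
      have := Real.one_sub_sq_div_two_le_cos (x := θ - φ)
      have h1 := hθ.1
      have h2 := hθ.2
      nlinarith
    nlinarith [mul_le_mul_of_nonneg_left hcos (mul_nonneg hα hr)]
  rw [intervalIntegral.integral_const, smul_eq_mul] at h3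
  rw [h1]
  norm_num at *
  linarith
end

section
/- There exists T₀ > 0 with the following property. Let T ≥ T₀, α ∈ [0, 2.02], A > 0. Let h assign to each (x,y,θ,t) ∈ ℝ³ × [0,T] a symmetric 3×3 real matrix h(x,y,θ,t), depending continuously on (x,y,θ,t) and smoothly on ℝ³ × (0,T], such that: (i) h is 2π-periodic in θ; (ii) each entry satisfies the heat equation ∂_t h_{pq} = (∂²_x + ∂²_y + ∂²_θ) h_{pq} on ℝ³ × (0,T]; (iii) h is oscillatory: ∫₀^{2π} h(x,y,θ,t) dθ = 0 entrywise for all (x,y,t); (iv) ‖h(x,y,θ,0)‖ ≤ A·exp(α·√(x²+y²)) for all (x,y,θ), where ‖·‖ is the Frobenius norm; (v) h grows at most exponentially in space: there exist a, C > 0 with ‖h(x,y,θ,t)‖ ≤ C·exp(a·√(x²+y²)) on ℝ³ × [0,T]. Then ‖h(0,0,θ,T)‖ ≤ A·exp(2αT)·exp(−0.01·T) for every θ. -/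
/-- The Frobenius norm of a real `3×3` matrix. -/
noncomputable def frobNorm (M : Matrix (Fin 3) (Fin 3) ℝ) : ℝ :=
  Real.sqrt (∑ p, ∑ q, (M p q) ^ 2)

lemma aux_second {f W W' : ℝ → ℝ} {w'' x : ℝ} (hf : ContDiff ℝ 2 f)
    (hW : ∀ z, HasDerivAt W (W' z) z) (hW' : HasDerivAt W' w'' x)
    (hmax : IsLocalMax (fun z => f z - W z) x) : deriv (deriv f) x ≤ w'' := by
  by_contra hlt
  push Not at hlt
  have hfd : ∀ z, HasDerivAt f (deriv f z) z := fun z =>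
    ((hf.differentiable (by norm_num)) z).hasDerivAt
  have hfd2 : HasDerivAt (deriv f) (deriv (deriv f) x) x := by
    have h1 : ContDiff ℝ 1 (deriv f) := by
      have : ContDiff ℝ (1 + 1) f := by simpa [one_add_one_eq_two] using hf
      exact (contDiff_succ_iff_deriv.1 this).2.2
    exact ((h1.differentiable (by norm_num)) x).hasDerivAt
  have hd1 : ∀ z, HasDerivAt (fun z => f z - W z) (deriv f z - W' z) z :=
    fun z => (hfd z).sub (hW z)
  have hde : deriv (fun z => f z - W z) = fun z => deriv f z - W' z :=
    funext fun z => (hd1 z).deriv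
  have hd2 : HasDerivAt (deriv (fun z => f z - W z)) (deriv (deriv f) x - w'') x := by
    rw [hde]; exact hfd2.sub hW'
  have hmin : IsLocalMin (fun z => f z - W z) x := by
    apply isLocalMin_of_deriv_deriv_pos
    · rw [hd2.deriv]; linarith
    · exact hmax.deriv_eq_zero
    · exact (hd1 x).continuousAt
  have hc : (fun z => f z - W z) =ᶠ[nhds x] fun _ => f x - W x := by
    filter_upwards [hmax, hmin] with z h1 h2 using le_antisymm h1 h2
  have h3 := hc.deriv.deriv_eq
  rw [hd2.deriv] at h3
  simp at h3
  linarith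

lemma aux_time {f : ℝ → ℝ} {f' t : ℝ} (ht : 0 < t) (hf : HasDerivAt f f' t)
    (hle : ∀ s, 0 ≤ s → s ≤ t → f s ≤ f t) : 0 ≤ f' := by
  have h1 : Filter.Tendsto (slope f t) (nhdsWithin t (Set.Iio t)) (nhds f') :=
    (hasDerivAt_iff_tendsto_slope.1 hf).mono_left
      (nhdsWithin_mono _ (fun z hz => ne_of_lt hz))
  refine ge_of_tendsto h1 ?_
  have : Set.Ioo 0 t ∈ nhdsWithin t (Set.Iio t) := Ioo_mem_nhdsLT ht
  filter_upwards [this] with s hs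
  rw [slope_def_field]
  apply div_nonneg_of_nonpos
  · linarith [hle s hs.1.le hs.2.le]
  · linarith [hs.2]

lemma aux_exp1 (b k z : ℝ) (hk : 0 < k) :
    HasDerivAt (fun z => Real.exp (b * Real.sqrt (k + z ^ 2)))
      (Real.exp (b * Real.sqrt (k + z ^ 2)) * (b * (z / Real.sqrt (k + z ^ 2)))) z := by
  have hp : 0 < k + z ^ 2 := by positivity
  have h0 : HasDerivAt (fun z : ℝ => k + z ^ 2) (2 * z) z := by
    simpa using ((hasDerivAt_pow 2 z).const_add k)
  have h1 := h0.sqrt hp.ne'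
  have h2 := (h1.const_mul b).exp
  convert h2 using 3
  field_simp

lemma aux_exp2 (b k z : ℝ) (hk : 0 < k) :
    HasDerivAt (fun z => Real.exp (b * Real.sqrt (k + z ^ 2)) * (b * (z / Real.sqrt (k + z ^ 2))))
      (Real.exp (b * Real.sqrt (k + z ^ 2)) * (b ^ 2 * z ^ 2 / (k + z ^ 2)
        + b * (1 / Real.sqrt (k + z ^ 2) - z ^ 2 / (Real.sqrt (k + z ^ 2)) ^ 3))) z := by
  have hp : 0 < k + z ^ 2 := by positivity
  have h0 : HasDerivAt (fun z : ℝ => k + z ^ 2) (2 * z) z := by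
    simpa using ((hasDerivAt_pow 2 z).const_add k)
  have h1 := h0.sqrt hp.ne'
  have hs : 0 < Real.sqrt (k + z ^ 2) := Real.sqrt_pos.2 hp
  have h2 := (aux_exp1 b k z hk).mul (((hasDerivAt_id z).div h1 hs.ne').const_mul b)
  refine h2.congr_deriv ?_
  simp only [Pi.div_apply, id]
  have hq : k + z ^ 2 = Real.sqrt (k + z ^ 2) ^ 2 := (Real.sq_sqrt hp.le).symm
  set S := Real.sqrt (k + z ^ 2)
  rw [hq]
  field_simp

/-- second derivative formula -/
noncomputable def auxD (b k z : ℝ) : ℝ :=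
  Real.exp (b * Real.sqrt (k + z ^ 2)) * (b ^ 2 * z ^ 2 / (k + z ^ 2)
        + b * (1 / Real.sqrt (k + z ^ 2) - z ^ 2 / (Real.sqrt (k + z ^ 2)) ^ 3))

lemma aux_lap (b x y : ℝ) (hb : 0 ≤ b) :
    auxD b (1600 + y ^ 2) x + auxD b (1600 + x ^ 2) y
      ≤ Real.exp (b * Real.sqrt (1600 + y ^ 2 + x ^ 2)) * (b ^ 2 + b / 20) := by
  unfold auxD
  have e : 1600 + x ^ 2 + y ^ 2 = 1600 + y ^ 2 + x ^ 2 := by ring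
  rw [e, ← mul_add]
  apply mul_le_mul_of_nonneg_left _ (Real.exp_pos _).le
  have hp : 0 < 1600 + y ^ 2 + x ^ 2 := by positivity
  have hS : 40 ≤ Real.sqrt (1600 + y ^ 2 + x ^ 2) := by
    apply Real.le_sqrt_of_sq_le; nlinarith [sq_nonneg x, sq_nonneg y]
  set S := Real.sqrt (1600 + y ^ 2 + x ^ 2)
  have h1 : b ^ 2 * x ^ 2 / (1600 + y ^ 2 + x ^ 2) + b ^ 2 * y ^ 2 / (1600 + y ^ 2 + x ^ 2) ≤ b ^ 2 := by
    rw [← add_div, div_le_iff₀ hp]; nlinarith [sq_nonneg b]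
  have h2 : 1 / S ≤ 1 / 40 := one_div_le_one_div_of_le (by norm_num) hS
  have h3 : 0 ≤ x ^ 2 / S ^ 3 := by positivity
  have h4 : 0 ≤ y ^ 2 / S ^ 3 := by positivity
  have h5 : b * (1 / S - x ^ 2 / S ^ 3) ≤ b * (1 / 40) := mul_le_mul_of_nonneg_left (by linarith) hb
  have h6 : b * (1 / S - y ^ 2 / S ^ 3) ≤ b * (1 / 40) := mul_le_mul_of_nonneg_left (by linarith) hb
  linarith

/-- the spatial profile -/
noncomputable def auxP (b x y : ℝ) : ℝ := Real.exp (b * Real.sqrt (1600 + y ^ 2 + x ^ 2))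

/-- the barrier -/
noncomputable def auxW (A α b ε x y θ₁ θ₂ t : ℝ) : ℝ :=
  4 * A * auxP α x y * Real.exp ((α ^ 2 + α / 20 - 2 / 9) * t) * Real.cos ((θ₁ - θ₂ - Real.pi) / 3)
    + ε * (auxP b x y * Real.exp ((b ^ 2 + b / 20) * t) + θ₁ ^ 2 + θ₂ ^ 2 + 5 * t)

lemma auxP_le (b x y : ℝ) (hb : 0 ≤ b) : Real.exp (b * Real.sqrt (x ^ 2 + y ^ 2)) ≤ auxP b x y := by
  unfold auxP
  apply Real.exp_le_exp.2
  apply mul_le_mul_of_nonneg_left _ hb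
  apply Real.sqrt_le_sqrt
  linarith

lemma aux_cos (s : ℝ) (h0 : 0 ≤ s) (h1 : s ≤ 2 * Real.pi) : 1 / 2 ≤ Real.cos ((s - Real.pi) / 3) := by
  rw [← Real.cos_pi_div_three, ← Real.cos_abs ((s - Real.pi) / 3)]
  apply Real.cos_le_cos_of_nonneg_of_le_pi (abs_nonneg _)
  · linarith [Real.pi_pos]
  · rw [abs_le]; constructor <;> linarith

lemma auxP_symm (b x y : ℝ) : auxP b x y = auxP b y x := by
  unfold auxP; congr 3; ring

lemma auxP_pos (b x y : ℝ) : 0 < auxP b x y := Real.exp_pos _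

lemma auxsq (z : ℝ) : |z| ≤ z ^ 2 + 1 := by
  have := sq_abs z
  nlinarith [sq_nonneg (|z| - 1), abs_nonneg z]

set_option maxHeartbeats 4000000 in
lemma aux_key {T A α a C ε : ℝ} (hα : 0 ≤ α) (hA : 0 < A) (ha : 0 < a) (hC : 0 < C)
    (hε : 0 < ε) (u : ℝ → ℝ → ℝ → ℝ → ℝ)
    (hc : ContinuousOn (fun v : ℝ × ℝ × ℝ × ℝ => u v.1 v.2.1 v.2.2.1 v.2.2.2)
        (Set.univ ×ˢ Set.univ ×ˢ Set.univ ×ˢ Set.Icc 0 T))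
    (hs : ContDiffOn ℝ (⊤ : ℕ∞) (fun v : ℝ × ℝ × ℝ × ℝ => u v.1 v.2.1 v.2.2.1 v.2.2.2)
        (Set.univ ×ˢ Set.univ ×ˢ Set.univ ×ˢ Set.Ioc 0 T))
    (hper : ∀ x y θ t : ℝ, u x y (θ + 2 * Real.pi) t = u x y θ t)
    (heat : ∀ x y θ : ℝ, ∀ t ∈ Set.Ioc (0:ℝ) T,
        deriv (fun t' => u x y θ t') t
          = deriv (deriv (fun x' => u x' y θ t)) x
            + deriv (deriv (fun y' => u x y' θ t)) y
            + deriv (deriv (fun θ' => u x y θ' t)) θ)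
    (hini : ∀ x y θ : ℝ, |u x y θ 0| ≤ A * Real.exp (α * Real.sqrt (x ^ 2 + y ^ 2)))
    (hgr : ∀ x y θ : ℝ, ∀ t ∈ Set.Icc (0:ℝ) T,
        |u x y θ t| ≤ C * Real.exp (a * Real.sqrt (x ^ 2 + y ^ 2)))
    {x y θ₁ θ₂ t : ℝ} (ht0 : 0 ≤ t) (htT : t < T) (hs0 : 0 ≤ θ₁ - θ₂) (hs1 : θ₁ - θ₂ ≤ 2 * Real.pi) :
    u x y θ₁ t - u x y θ₂ t < auxW A α (a + 1) ε x y θ₁ θ₂ t := by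
  by_contra hcon
  push Not at hcon
  have hπ := Real.pi_pos
  set b := a + 1 with hb
  have hb0 : 0 ≤ b := by linarith
  -- parts of the barrier
  have hW1 : ∀ x y θ₁ θ₂ s : ℝ, 0 ≤ θ₁ - θ₂ → θ₁ - θ₂ ≤ 2 * Real.pi →
      0 ≤ 4 * A * auxP α x y * Real.exp ((α ^ 2 + α / 20 - 2 / 9) * s)
        * Real.cos ((θ₁ - θ₂ - Real.pi) / 3) := by
    intro x y θ₁ θ₂ s h0 h1
    have := aux_cos _ h0 h1
    have := auxP_pos α x y
    positivity
  set Q := 2 * C * Real.exp (a * (2 * C / ε)) / ε with hQ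
  have hQ0 : 0 < Q := by positivity
  set R := 2 * C / ε + Q + 1 with hR
  have hbox : ∀ x y θ₁ θ₂ s : ℝ, 0 ≤ s → s ≤ t → 0 ≤ θ₁ - θ₂ → θ₁ - θ₂ ≤ 2 * Real.pi →
      auxW A α b ε x y θ₁ θ₂ s ≤ u x y θ₁ s - u x y θ₂ s →
      |x| ≤ R ∧ |y| ≤ R ∧ |θ₁| ≤ R ∧ |θ₂| ≤ R := by
    intro x y θ₁ θ₂ s h0 h1 h2 h3 h4
    have hw := hW1 x y θ₁ θ₂ s h2 h3
    have hsT : s ∈ Set.Icc (0:ℝ) T := ⟨h0, by linarith⟩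
    have g1 := (abs_le.1 (hgr x y θ₁ s hsT)).2
    have g2 := (abs_le.1 (hgr x y θ₂ s hsT)).1
    set r := Real.sqrt (x ^ 2 + y ^ 2) with hr
    have hr0 : 0 ≤ r := Real.sqrt_nonneg _
    have hP := auxP_le b x y hb0
    rw [← hr] at hP
    have he : 1 ≤ Real.exp ((b ^ 2 + b / 20) * s) := Real.one_le_exp (by positivity)
    have hPe : Real.exp (b * r) ≤ auxP b x y * Real.exp ((b ^ 2 + b / 20) * s) := by
      nlinarith [auxP_pos b x y]
    have hmain : ε * (Real.exp (b * r) + θ₁ ^ 2 + θ₂ ^ 2) ≤ 2 * C * Real.exp (a * r) := by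
      have : ε * (Real.exp (b * r) + θ₁ ^ 2 + θ₂ ^ 2) ≤
        ε * (auxP b x y * Real.exp ((b ^ 2 + b / 20) * s) + θ₁ ^ 2 + θ₂ ^ 2 + 5 * s) := by
        apply mul_le_mul_of_nonneg_left _ hε.le
        linarith
      unfold auxW at h4
      linarith
    have hexp : Real.exp (b * r) = Real.exp (a * r) * Real.exp r := by
      rw [← Real.exp_add, hb]; congr 1; ring
    have hrle : r ≤ 2 * C / ε := by
      rw [le_div_iff₀ hε]
      have h5 : ε * Real.exp (b * r) ≤ 2 * C * Real.exp (a * r) := by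
        refine le_trans ?_ hmain
        apply mul_le_mul_of_nonneg_left _ hε.le
        nlinarith [sq_nonneg θ₁, sq_nonneg θ₂]
      rw [hexp] at h5
      have h6 : ε * Real.exp r ≤ 2 * C := by
        have := Real.exp_pos (a * r)
        by_contra hh
        push Not at hh
        nlinarith
      have h7 : r ≤ Real.exp r := by linarith [Real.add_one_le_exp r]
      nlinarith
    have hth : θ₁ ^ 2 + θ₂ ^ 2 ≤ Q := by
      rw [hQ, le_div_iff₀ hε]
      have h5 : Real.exp (a * r) ≤ Real.exp (a * (2 * C / ε)) :=
        Real.exp_le_exp.2 (mul_le_mul_of_nonneg_left hrle ha.le)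
      have h6 : ε * (θ₁ ^ 2 + θ₂ ^ 2) ≤ ε * (Real.exp (b * r) + θ₁ ^ 2 + θ₂ ^ 2) := by
        apply mul_le_mul_of_nonneg_left _ hε.le
        linarith [Real.exp_pos (b * r)]
      have h7 := mul_le_mul_of_nonneg_left h5 (show 0 ≤ 2 * C by positivity)
      linarith
    have hCe : 0 < 2 * C / ε := by positivity
    have hx : |x| ≤ r := Real.abs_le_sqrt (by nlinarith [sq_nonneg y])
    have hy : |y| ≤ r := Real.abs_le_sqrt (by nlinarith [sq_nonneg x])
    refine ⟨by linarith, by linarith, ?_, ?_⟩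
    · have h5 := auxsq θ₁
      have h6 := sq_nonneg θ₂
      linarith
    · have h5 := auxsq θ₂
      have h6 := sq_nonneg θ₁
      linarith
  -- maximum point
  let g : ℝ × ℝ × ℝ × ℝ × ℝ → ℝ := fun p =>
    u p.1 p.2.1 p.2.2.1 p.2.2.2.2 - u p.1 p.2.1 p.2.2.2.1 p.2.2.2.2
      - auxW A α b ε p.1 p.2.1 p.2.2.1 p.2.2.2.1 p.2.2.2.2
  let K : Set (ℝ × ℝ × ℝ × ℝ × ℝ) :=
    (Set.Icc (-R) R ×ˢ Set.Icc (-R) R ×ˢ Set.Icc (-R) R ×ˢ Set.Icc (-R) R ×ˢ Set.Icc 0 t) ∩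
      {p | p.2.2.1 - p.2.2.2.1 ∈ Set.Icc 0 (2 * Real.pi)}
  have hK : IsCompact K := by
    apply IsCompact.inter_right
    · exact isCompact_Icc.prod (isCompact_Icc.prod (isCompact_Icc.prod (isCompact_Icc.prod isCompact_Icc)))
    · exact isClosed_Icc.preimage (by fun_prop)
  have hgc : ContinuousOn g K := by
    have hWc : Continuous (fun p : ℝ × ℝ × ℝ × ℝ × ℝ =>
        auxW A α b ε p.1 p.2.1 p.2.2.1 p.2.2.2.1 p.2.2.2.2) := by
      unfold auxW auxP
      fun_prop
    have h1 : ContinuousOn (fun p : ℝ × ℝ × ℝ × ℝ × ℝ => u p.1 p.2.1 p.2.2.1 p.2.2.2.2) K := by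
      refine hc.comp (f := fun p : ℝ × ℝ × ℝ × ℝ × ℝ => (p.1, p.2.1, p.2.2.1, p.2.2.2.2)) (by fun_prop) ?_
      rintro ⟨p1, p2, p3, p4, p5⟩ ⟨⟨_, _, _, _, hp⟩, _⟩
      simp only [Set.mem_prod, Set.mem_univ, true_and]
      exact ⟨hp.1, hp.2.trans htT.le⟩
    have h2 : ContinuousOn (fun p : ℝ × ℝ × ℝ × ℝ × ℝ => u p.1 p.2.1 p.2.2.2.1 p.2.2.2.2) K := by
      refine hc.comp (f := fun p : ℝ × ℝ × ℝ × ℝ × ℝ => (p.1, p.2.1, p.2.2.2.1, p.2.2.2.2)) (by fun_prop) ?_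
      rintro ⟨p1, p2, p3, p4, p5⟩ ⟨⟨_, _, _, _, hp⟩, _⟩
      simp only [Set.mem_prod, Set.mem_univ, true_and]
      exact ⟨hp.1, hp.2.trans htT.le⟩
    exact (h1.sub h2).sub hWc.continuousOn
  have hmemK : ∀ x y θ₁ θ₂ s : ℝ, 0 ≤ s → s ≤ t → 0 ≤ θ₁ - θ₂ → θ₁ - θ₂ ≤ 2 * Real.pi →
      auxW A α b ε x y θ₁ θ₂ s ≤ u x y θ₁ s - u x y θ₂ s → (x, y, θ₁, θ₂, s) ∈ K := by
    intro x y θ₁ θ₂ s h0 h1 h2 h3 h4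
    obtain ⟨i1, i2, i3, i4⟩ := hbox x y θ₁ θ₂ s h0 h1 h2 h3 h4
    exact ⟨⟨abs_le.1 i1, abs_le.1 i2, abs_le.1 i3, abs_le.1 i4, h0, h1⟩, h2, h3⟩
  have hpK := hmemK x y θ₁ θ₂ t ht0 le_rfl hs0 hs1 hcon
  obtain ⟨⟨X, Y, P, S, τ⟩, hqK, hqmax⟩ := hK.exists_isMaxOn ⟨_, hpK⟩ hgc
  have hg0 : 0 ≤ g (X, Y, P, S, τ) := le_trans (by simp only [g]; linarith) (hqmax hpK)
  have hglob : ∀ x y θ₁ θ₂ s : ℝ, 0 ≤ s → s ≤ t → 0 ≤ θ₁ - θ₂ → θ₁ - θ₂ ≤ 2 * Real.pi →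
      g (x, y, θ₁, θ₂, s) ≤ g (X, Y, P, S, τ) := by
    intro x y θ₁ θ₂ s h0 h1 h2 h3
    by_cases h4 : auxW A α b ε x y θ₁ θ₂ s ≤ u x y θ₁ s - u x y θ₂ s
    · exact hqmax (hmemK x y θ₁ θ₂ s h0 h1 h2 h3 h4)
    · refine le_trans ?_ hg0
      simp only [g]; linarith
  obtain ⟨⟨_, _, _, _, hτ⟩, hPS⟩ := hqK
  simp only [Set.mem_ofPred_eq] at hτ hPS
  obtain ⟨hPS0, hPS1⟩ := hPS
  clear hqmax hpK hmemK hgc hK hbox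
  simp only [g] at hg0
  have hw := hW1 X Y P S τ hPS0 hPS1
  have hPb := auxP_pos b X Y
  have hPα := auxP_pos α X Y
  have hwe : 0 < ε * (auxP b X Y * Real.exp ((b ^ 2 + b / 20) * τ) + P ^ 2 + S ^ 2 + 5 * τ) := by
    have := hτ.1
    have h1 : 0 < auxP b X Y * Real.exp ((b ^ 2 + b / 20) * τ) := by positivity
    have h2 : 0 < auxP b X Y * Real.exp ((b ^ 2 + b / 20) * τ) + P ^ 2 + S ^ 2 + 5 * τ := by
      nlinarith [sq_nonneg P, sq_nonneg S]
    positivity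
  have hcos := aux_cos _ hPS0 hPS1
  have hτ0 : 0 < τ := by
    rcases hτ.1.lt_or_eq with h | h
    · exact h
    exfalso
    subst h
    have g1 := (abs_le.1 (hini X Y P)).2
    have g2 := (abs_le.1 (hini X Y S)).1
    have g3 := auxP_le α X Y hα
    unfold auxW at hg0
    have g4 : 2 * (A * auxP α X Y) ≤ 4 * A * auxP α X Y * Real.exp ((α ^ 2 + α / 20 - 2 / 9) * 0)
        * Real.cos ((P - S - Real.pi) / 3) := by
      simp only [mul_zero, Real.exp_zero, mul_one]
      have : 0 < A * auxP α X Y := by positivity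
      nlinarith
    have g5 : A * Real.exp (α * Real.sqrt (X ^ 2 + Y ^ 2)) ≤ A * auxP α X Y :=
      mul_le_mul_of_nonneg_left g3 hA.le
    linarith
  have hPS0' : 0 < P - S := by
    rcases hPS0.lt_or_eq with h | h
    · exact h
    exfalso
    have : P = S := by linarith
    subst this
    unfold auxW at hg0
    linarith
  have hPS1' : P - S < 2 * Real.pi := by
    rcases hPS1.lt_or_eq with h | h
    · exact h
    exfalso
    have : P = S + 2 * Real.pi := by linarith
    subst this
    rw [hper] at hg0
    unfold auxW at hg0
    linarith
  have hτT : τ ∈ Set.Ioo 0 T := ⟨hτ0, by linarith [hτ.2]⟩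
  have hτT' : τ ∈ Set.Ioc 0 T := ⟨hτ0, hτT.2.le⟩
  -- smoothness of slices
  have sx : ∀ y θ : ℝ, ContDiff ℝ 2 (fun x' => u x' y θ τ) := by
    intro y θ
    have := (hs.of_le (m := 2) (by exact WithTop.coe_le_coe.2 (le_top : (2:ℕ∞) ≤ ⊤))).comp_contDiff
      (f := fun x' : ℝ => (x', y, θ, τ)) (by fun_prop)
      (by intro z; simp only [Set.mem_prod, Set.mem_univ, true_and]; exact hτT')
    exact this
  have sy : ∀ x θ : ℝ, ContDiff ℝ 2 (fun y' => u x y' θ τ) := by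
    intro x θ
    have := (hs.of_le (m := 2) (by exact WithTop.coe_le_coe.2 (le_top : (2:ℕ∞) ≤ ⊤))).comp_contDiff
      (f := fun y' : ℝ => (x, y', θ, τ)) (by fun_prop)
      (by intro z; simp only [Set.mem_prod, Set.mem_univ, true_and]; exact hτT')
    exact this
  have sθ : ∀ x y : ℝ, ContDiff ℝ 2 (fun θ' => u x y θ' τ) := by
    intro x y
    have := (hs.of_le (m := 2) (by exact WithTop.coe_le_coe.2 (le_top : (2:ℕ∞) ≤ ⊤))).comp_contDiff
      (f := fun θ' : ℝ => (x, y, θ', τ)) (by fun_prop)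
      (by intro z; simp only [Set.mem_prod, Set.mem_univ, true_and]; exact hτT')
    exact this
  have st : ∀ x y θ : ℝ, HasDerivAt (fun t' => u x y θ t') (deriv (fun t' => u x y θ t') τ) τ := by
    intro x y θ
    have h1 : ContDiffOn ℝ 2 (fun t' => u x y θ t') (Set.Ioc 0 T) := by
      have := (hs.of_le (m := 2) (by exact WithTop.coe_le_coe.2 (le_top : (2:ℕ∞) ≤ ⊤))).comp
        (f := fun t' : ℝ => (x, y, θ, t')) (s := Set.Ioc 0 T) (by fun_prop)
        (by intro z hz; simp only [Set.mem_prod, Set.mem_univ, true_and]; exact hz)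
      exact this
    have h2 := (h1.contDiffAt (Ioc_mem_nhds hτT.1 hτT.2)).differentiableAt (by norm_num)
    exact h2.hasDerivAt
  -- abbreviations
  set c := Real.cos ((P - S - Real.pi) / 3) with hcdef
  set Eα := Real.exp ((α ^ 2 + α / 20 - 2 / 9) * τ) with hEα
  set Eb := Real.exp ((b ^ 2 + b / 20) * τ) with hEb
  have hEα0 : 0 < Eα := Real.exp_pos _
  have hEb0 : 0 < Eb := Real.exp_pos _
  have subdd : ∀ (f1 f2 : ℝ → ℝ) (z : ℝ), ContDiff ℝ 2 f1 → ContDiff ℝ 2 f2 →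
      deriv (deriv (fun z => f1 z - f2 z)) z = deriv (deriv f1) z - deriv (deriv f2) z := by
    intro f1 f2 z h1 h2
    have d1 := h1.differentiable (by norm_num)
    have d2 := h2.differentiable (by norm_num)
    have e : deriv (fun z => f1 z - f2 z) = fun z => deriv f1 z - deriv f2 z :=
      funext fun z => ((d1 z).hasDerivAt.sub (d2 z).hasDerivAt).deriv
    have dd : ∀ f : ℝ → ℝ, ContDiff ℝ 2 f → Differentiable ℝ (deriv f) := by
      intro f hf
      have : ContDiff ℝ (1 + 1) f := by simpa [one_add_one_eq_two] using hf
      exact (contDiff_succ_iff_deriv.1 this).2.2.differentiable (by norm_num)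
    rw [e]
    exact ((dd f1 h1 z).hasDerivAt.sub (dd f2 h2 z).hasDerivAt).deriv
  -- x direction
  have ix : deriv (deriv (fun x' => u x' Y P τ)) X - deriv (deriv (fun x' => u x' Y S τ)) X
      ≤ 4 * A * Eα * c * auxD α (1600 + Y ^ 2) X + ε * Eb * auxD b (1600 + Y ^ 2) X := by
    rw [← subdd _ _ _ (sx Y P) (sx Y S)]
    have k0 : 0 < 1600 + Y ^ 2 := by positivity
    refine aux_second (W := fun z => auxW A α b ε z Y P S τ) ((sx Y P).sub (sx Y S))
      (fun z => ?_) (((aux_exp2 α _ X k0).const_mul (4 * A * Eα * c)).add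
        ((aux_exp2 b _ X k0).const_mul (ε * Eb))) ?_
    · have := (((aux_exp1 α _ z k0).const_mul (4 * A * Eα * c)).add
        ((aux_exp1 b _ z k0).const_mul (ε * Eb))).add_const (ε * (P ^ 2 + S ^ 2 + 5 * τ))
      refine this.congr_of_eventuallyEq (Filter.Eventually.of_forall fun w => ?_)
      simp only [auxW, auxP, Pi.add_apply]
      ring
    · exact Filter.Eventually.of_forall fun z => hglob z Y P S τ hτ.1 hτ.2 hPS0 hPS1
  have iy : deriv (deriv (fun y' => u X y' P τ)) Y - deriv (deriv (fun y' => u X y' S τ)) Y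
      ≤ 4 * A * Eα * c * auxD α (1600 + X ^ 2) Y + ε * Eb * auxD b (1600 + X ^ 2) Y := by
    rw [← subdd _ _ _ (sy X P) (sy X S)]
    have k0 : 0 < 1600 + X ^ 2 := by positivity
    refine aux_second (W := fun z => auxW A α b ε X z P S τ) ((sy X P).sub (sy X S))
      (fun z => ?_) (((aux_exp2 α _ Y k0).const_mul (4 * A * Eα * c)).add
        ((aux_exp2 b _ Y k0).const_mul (ε * Eb))) ?_
    · have := (((aux_exp1 α _ z k0).const_mul (4 * A * Eα * c)).add
        ((aux_exp1 b _ z k0).const_mul (ε * Eb))).add_const (ε * (P ^ 2 + S ^ 2 + 5 * τ))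
      refine this.congr_of_eventuallyEq (Filter.Eventually.of_forall fun w => ?_)
      simp only [auxW, Pi.add_apply]
      rw [auxP_symm α, auxP_symm b]
      simp only [auxP]
      ring
    · exact Filter.Eventually.of_forall fun z => hglob X z P S τ hτ.1 hτ.2 hPS0 hPS1
  -- first angle
  have i1 : deriv (deriv (fun θ' => u X Y θ' τ)) P
      ≤ -(4 * A * auxP α X Y * Eα * c / 9) + ε * 2 := by
    have l0 : ∀ z : ℝ, HasDerivAt (fun z : ℝ => (z - S - Real.pi) / 3) (1 / 3) z := fun z =>
      (((hasDerivAt_id z).sub_const S).sub_const Real.pi).div_const 3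
    refine aux_second (W := fun z => u X Y S τ + auxW A α b ε X Y z S τ)
      (W' := fun z => 4 * A * auxP α X Y * Eα * (-Real.sin ((z - S - Real.pi) / 3) * (1 / 3))
        + ε * (2 * z)) (sθ X Y) (fun z => ?_) ?_ ?_
    · have := (((l0 z).cos.const_mul (4 * A * auxP α X Y * Eα)).add
        ((hasDerivAt_pow 2 z).const_mul ε)).add_const
          (u X Y S τ + ε * (auxP b X Y * Eb + S ^ 2 + 5 * τ))
      refine (this.congr_of_eventuallyEq (Filter.Eventually.of_forall fun w => ?_)).congr_deriv ?_
      · simp only [auxW, Pi.add_apply]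
        ring
      · norm_num
    · have := (((l0 P).sin.neg.mul_const (1 / 3)).const_mul (4 * A * auxP α X Y * Eα)).add
        (((hasDerivAt_id P).const_mul 2).const_mul ε)
      refine this.congr_deriv ?_
      rw [← hcdef]; ring
    · have : ∀ᶠ z in nhds P, z - S ∈ Set.Ioo 0 (2 * Real.pi) :=
        (continuous_id.sub continuous_const).continuousAt.eventually (isOpen_Ioo.mem_nhds ⟨hPS0', hPS1'⟩)
      filter_upwards [this] with z hz
      have := hglob X Y z S τ hτ.1 hτ.2 hz.1.le hz.2.le
      simp only [g] at this
      linarith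
  have i2 : deriv (deriv (fun θ' => 0 - u X Y θ' τ)) S
      ≤ -(4 * A * auxP α X Y * Eα * c / 9) + ε * 2 := by
    have l0 : ∀ z : ℝ, HasDerivAt (fun z : ℝ => (P - z - Real.pi) / 3) (-1 / 3) z := fun z =>
      (((hasDerivAt_id z).const_sub P).sub_const Real.pi).div_const 3
    refine aux_second (W := fun z => - u X Y P τ + auxW A α b ε X Y P z τ)
      (W' := fun z => 4 * A * auxP α X Y * Eα * (-Real.sin ((P - z - Real.pi) / 3) * (-1 / 3))
        + ε * (2 * z)) (contDiff_const.sub (sθ X Y)) (fun z => ?_) ?_ ?_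
    · have := (((l0 z).cos.const_mul (4 * A * auxP α X Y * Eα)).add
        ((hasDerivAt_pow 2 z).const_mul ε)).add_const
          (- u X Y P τ + ε * (auxP b X Y * Eb + P ^ 2 + 5 * τ))
      refine (this.congr_of_eventuallyEq (Filter.Eventually.of_forall fun w => ?_)).congr_deriv ?_
      · simp only [auxW, Pi.add_apply]
        ring
      · norm_num
    · have := (((l0 S).sin.neg.mul_const (-1 / 3)).const_mul (4 * A * auxP α X Y * Eα)).add
        (((hasDerivAt_id S).const_mul 2).const_mul ε)
      refine this.congr_deriv ?_
      rw [← hcdef]; ring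
    · have : ∀ᶠ z in nhds S, P - z ∈ Set.Ioo 0 (2 * Real.pi) :=
        (continuous_const.sub continuous_id).continuousAt.eventually (isOpen_Ioo.mem_nhds ⟨hPS0', hPS1'⟩)
      filter_upwards [this] with z hz
      have := hglob X Y P z τ hτ.1 hτ.2 hz.1.le hz.2.le
      simp only [g] at this
      linarith
  rw [subdd (fun _ => 0) _ _ contDiff_const (sθ X Y)] at i2
  simp only [deriv_const', deriv_const, zero_sub] at i2
  -- time
  have it : 0 ≤ deriv (fun t' => u X Y P t') τ - deriv (fun t' => u X Y S t') τ
      - (4 * A * auxP α X Y * c * (Eα * (α ^ 2 + α / 20 - 2 / 9))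
        + ε * (auxP b X Y * (Eb * (b ^ 2 + b / 20)) + 5)) := by
    have le : ∀ k : ℝ, HasDerivAt (fun s : ℝ => Real.exp (k * s)) (Real.exp (k * τ) * k) τ := fun k => by
      simpa using ((hasDerivAt_id τ).const_mul k).exp
    have hWt : HasDerivAt (fun s => auxW A α b ε X Y P S s)
        (4 * A * auxP α X Y * c * (Eα * (α ^ 2 + α / 20 - 2 / 9))
        + ε * (auxP b X Y * (Eb * (b ^ 2 + b / 20)) + 5)) τ := by
      have := (((le (α ^ 2 + α / 20 - 2 / 9)).const_mul (4 * A * auxP α X Y * c)).add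
        ((((le (b ^ 2 + b / 20)).const_mul (auxP b X Y)).add
          ((hasDerivAt_id τ).const_mul 5)).const_mul ε)).add_const (ε * (P ^ 2 + S ^ 2))
      refine (this.congr_of_eventuallyEq (Filter.Eventually.of_forall fun w => ?_)).congr_deriv ?_
      · simp only [auxW, Pi.add_apply, id]
        ring
      · simp [hEα, hEb]
    refine aux_time (f := fun s => g (X, Y, P, S, s)) hτ0 (((st X Y P).sub (st X Y S)).sub hWt) ?_
    intro s h0 h1
    exact hglob X Y P S s h0 (h1.trans hτ.2) hPS0 hPS1
  have e1 := heat X Y P τ hτT'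
  have e2 := heat X Y S τ hτT'
  have L1 := mul_le_mul_of_nonneg_left (aux_lap α X Y hα) (show 0 ≤ 4 * A * Eα * c by positivity)
  have L2 := mul_le_mul_of_nonneg_left (aux_lap b X Y hb0) (show 0 ≤ ε * Eb by positivity)
  change _ ≤ 4 * A * Eα * c * (auxP α X Y * _) at L1
  change _ ≤ ε * Eb * (auxP b X Y * _) at L2
  rw [e1, e2] at it
  ring_nf at it L1 L2 ix iy i1 i2
  linarith

lemma aux_scalar {T A α a C : ℝ} (hT : 0 < T) (hα : 0 ≤ α) (hA : 0 < A) (ha : 0 < a) (hC : 0 < C)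
    (u : ℝ → ℝ → ℝ → ℝ → ℝ)
    (hc : ContinuousOn (fun v : ℝ × ℝ × ℝ × ℝ => u v.1 v.2.1 v.2.2.1 v.2.2.2)
        (Set.univ ×ˢ Set.univ ×ˢ Set.univ ×ˢ Set.Icc 0 T))
    (hs : ContDiffOn ℝ (⊤ : ℕ∞) (fun v : ℝ × ℝ × ℝ × ℝ => u v.1 v.2.1 v.2.2.1 v.2.2.2)
        (Set.univ ×ˢ Set.univ ×ˢ Set.univ ×ˢ Set.Ioc 0 T))
    (hper : ∀ x y θ t : ℝ, u x y (θ + 2 * Real.pi) t = u x y θ t)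
    (heat : ∀ x y θ : ℝ, ∀ t ∈ Set.Ioc (0:ℝ) T,
        deriv (fun t' => u x y θ t') t
          = deriv (deriv (fun x' => u x' y θ t)) x
            + deriv (deriv (fun y' => u x y' θ t)) y
            + deriv (deriv (fun θ' => u x y θ' t)) θ)
    (hmean : ∀ x y : ℝ, ∀ t ∈ Set.Icc (0:ℝ) T, (∫ θ in (0:ℝ)..(2 * Real.pi), u x y θ t) = 0)
    (hini : ∀ x y θ : ℝ, |u x y θ 0| ≤ A * Real.exp (α * Real.sqrt (x ^ 2 + y ^ 2)))
    (hgr : ∀ x y θ : ℝ, ∀ t ∈ Set.Icc (0:ℝ) T,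
        |u x y θ t| ≤ C * Real.exp (a * Real.sqrt (x ^ 2 + y ^ 2))) (θ : ℝ) :
    |u 0 0 θ T| ≤ 4 * A * Real.exp (α * 40) * Real.exp ((α ^ 2 + α / 20 - 2 / 9) * T) := by
  have hπ := Real.pi_pos
  have hP0 : auxP α 0 0 = Real.exp (α * 40) := by
    unfold auxP
    congr 2
    rw [show (1600:ℝ) + 0 ^ 2 + 0 ^ 2 = 40 ^ 2 by norm_num]
    exact Real.sqrt_sq (by norm_num)
  set B : ℝ → ℝ := fun t => 4 * A * Real.exp (α * 40) * Real.exp ((α ^ 2 + α / 20 - 2 / 9) * t) with hB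
  -- two-point bound
  have h1 : ∀ t, 0 ≤ t → t < T → ∀ θ₁ θ₂, 0 ≤ θ₁ - θ₂ → θ₁ - θ₂ ≤ 2 * Real.pi →
      u 0 0 θ₁ t - u 0 0 θ₂ t ≤ B t := by
    intro t ht0 htT θ₁ θ₂ hs0 hs1
    set D := auxP (a + 1) 0 0 * Real.exp (((a + 1) ^ 2 + (a + 1) / 20) * t) + θ₁ ^ 2 + θ₂ ^ 2 + 5 * t with hD
    have hD0 : 0 < D := by
      have := auxP_pos (a + 1) 0 0
      positivity
    apply le_of_forall_pos_le_add
    intro δ hδ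
    have := aux_key hα hA ha hC (div_pos hδ hD0) u hc hs hper heat hini hgr (x := 0) (y := 0) ht0 htT hs0 hs1
    unfold auxW at this
    rw [← hD, div_mul_cancel₀ _ hD0.ne', hP0] at this
    have h2 : 4 * A * Real.exp (α * 40) * Real.exp ((α ^ 2 + α / 20 - 2 / 9) * t) *
        Real.cos ((θ₁ - θ₂ - Real.pi) / 3) ≤ B t :=
      mul_le_of_le_one_right (by positivity) (Real.cos_le_one _)
    linarith
  have h2 : ∀ t, 0 ≤ t → t < T → ∀ θ₁ θ₂, u 0 0 θ₁ t - u 0 0 θ₂ t ≤ B t := by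
    intro t ht0 htT θ₁ θ₂
    have hp : Function.Periodic (fun θ => u 0 0 θ t) (2 * Real.pi) := fun z => hper 0 0 z t
    obtain ⟨z, hz, hze⟩ := hp.exists_mem_Ico (by positivity) θ₁ θ₂
    have := h1 t ht0 htT z θ₂ (by linarith [hz.1]) (by linarith [hz.2])
    have hze' : u 0 0 θ₁ t = u 0 0 z t := hze
    rw [hze']; exact this
  have h3 : ∀ t, 0 ≤ t → t < T → |u 0 0 θ t| ≤ B t := by
    intro t ht0 htT
    have hcont : Continuous (fun θ => u 0 0 θ t) := by
      have := hc.comp_continuous (f := fun θ : ℝ => ((0:ℝ), (0:ℝ), θ, t)) (by fun_prop)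
        (by intro z; simp only [Set.mem_prod, Set.mem_univ, true_and]; exact ⟨ht0, htT.le⟩)
      exact this
    have hm := hmean 0 0 t ⟨ht0, htT.le⟩
    rw [abs_le]
    constructor
    · by_contra hh
      push Not at hh
      have hpos : 0 < ∫ θ in (0:ℝ)..(2 * Real.pi), - u 0 0 θ t :=
        intervalIntegral.intervalIntegral_pos_of_pos (hcont.neg.intervalIntegrable _ _)
          (fun z => by linarith [h2 t ht0 htT z θ]) (by positivity)
      rw [intervalIntegral.integral_neg, hm] at hpos
      simp at hpos
    · by_contra hh
      push Not at hh
      have hpos : 0 < ∫ θ in (0:ℝ)..(2 * Real.pi), u 0 0 θ t :=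
        intervalIntegral.intervalIntegral_pos_of_pos (hcont.intervalIntegrable _ _)
          (fun z => by linarith [h2 t ht0 htT θ z]) (by positivity)
      rw [hm] at hpos
      exact lt_irrefl _ hpos
  have hcT : ContinuousOn (fun t => |u 0 0 θ t|) (Set.Icc 0 T) := by
    have := hc.comp (f := fun t : ℝ => ((0:ℝ), (0:ℝ), θ, t)) (s := Set.Icc 0 T) (by fun_prop)
        (by intro z hz; simp only [Set.mem_prod, Set.mem_univ, true_and]; exact hz)
    exact this.abs
  have hBc : Continuous B := by rw [hB]; fun_prop
  have hcl : T ∈ closure (Set.Ico 0 T) := by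
    rw [closure_Ico hT.ne]; exact ⟨hT.le, le_rfl⟩
  exact ContinuousWithinAt.closure_le hcl
    ((hcT T ⟨hT.le, le_rfl⟩).mono Set.Ico_subset_Icc_self) hBc.continuousWithinAt
    (fun t ht => h3 t ht.1 ht.2)

lemma aux_entry (M : Matrix (Fin 3) (Fin 3) ℝ) (p q : Fin 3) : |M p q| ≤ frobNorm M := by
  unfold frobNorm
  apply Real.abs_le_sqrt
  calc (M p q) ^ 2 ≤ ∑ q, (M p q) ^ 2 :=
        Finset.single_le_sum (f := fun q => (M p q) ^ 2) (fun _ _ => sq_nonneg _) (Finset.mem_univ q)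
    _ ≤ _ := Finset.single_le_sum (f := fun p => ∑ q, (M p q) ^ 2)
        (fun _ _ => Finset.sum_nonneg fun _ _ => sq_nonneg _) (Finset.mem_univ p)

lemma aux_frob (M : Matrix (Fin 3) (Fin 3) ℝ) (B : ℝ) (hB : 0 ≤ B) (h : ∀ p q, |M p q| ≤ B) :
    frobNorm M ≤ 3 * B := by
  unfold frobNorm
  apply Real.sqrt_le_iff.2 ⟨by positivity, ?_⟩
  have h1 : ∀ p q, (M p q) ^ 2 ≤ B ^ 2 := fun p q => sq_le_sq' (abs_le.1 (h p q)).1 (abs_le.1 (h p q)).2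
  calc _ ≤ ∑ _p : Fin 3, ∑ _q : Fin 3, B ^ 2 :=
        Finset.sum_le_sum fun p _ => Finset.sum_le_sum fun q _ => h1 p q
    _ = _ := by simp; ring

/-- Linear symmetry-improvement on the flat cylindrical plane `ℝ² × S¹`
(with `δ₀ = 0.01`): there is `T₀ > 0` such that for all `T ≥ T₀`,
`α ∈ [0, 2.02]` and `A > 0`, every oscillatory symmetric-matrix-valued
solution `h` of the componentwise heat equation which is `2π`-periodic in `θ`,
satisfies `‖h(·,0)‖ ≤ A·exp(α·√(x²+y²))` and grows at most exponentially in
space, obeys `‖h(0,0,θ,T)‖ ≤ A·exp(2αT)·exp(−0.01·T)`. -/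
theorem linear_symmetry_improvement :
    ∃ T₀ : ℝ, 0 < T₀ ∧ ∀ T : ℝ, T₀ ≤ T →
    ∀ α : ℝ, α ∈ Set.Icc (0:ℝ) 2.02 → ∀ A : ℝ, 0 < A →
    ∀ h : ℝ → ℝ → ℝ → ℝ → Matrix (Fin 3) (Fin 3) ℝ,
      (∀ x y θ : ℝ, ∀ t ∈ Set.Icc (0:ℝ) T, (h x y θ t).IsSymm) →
      (∀ p q : Fin 3, ContinuousOn
        (fun v : ℝ × ℝ × ℝ × ℝ => h v.1 v.2.1 v.2.2.1 v.2.2.2 p q)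
        (Set.univ ×ˢ Set.univ ×ˢ Set.univ ×ˢ Set.Icc 0 T)) →
      (∀ p q : Fin 3, ContDiffOn ℝ (⊤ : ℕ∞)
        (fun v : ℝ × ℝ × ℝ × ℝ => h v.1 v.2.1 v.2.2.1 v.2.2.2 p q)
        (Set.univ ×ˢ Set.univ ×ˢ Set.univ ×ˢ Set.Ioc 0 T)) →
      (∀ x y θ t : ℝ, h x y (θ + 2 * Real.pi) t = h x y θ t) →
      (∀ p q : Fin 3, ∀ x y θ : ℝ, ∀ t ∈ Set.Ioc (0:ℝ) T,
        deriv (fun t' => h x y θ t' p q) t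
          = deriv (deriv (fun x' => h x' y θ t p q)) x
            + deriv (deriv (fun y' => h x y' θ t p q)) y
            + deriv (deriv (fun θ' => h x y θ' t p q)) θ) →
      (∀ p q : Fin 3, ∀ x y : ℝ, ∀ t ∈ Set.Icc (0:ℝ) T,
        (∫ θ in (0:ℝ)..(2 * Real.pi), h x y θ t p q) = 0) →
      (∀ x y θ : ℝ, frobNorm (h x y θ 0) ≤ A * Real.exp (α * Real.sqrt (x ^ 2 + y ^ 2))) →
      (∃ a C : ℝ, 0 < a ∧ 0 < C ∧ ∀ x y θ : ℝ, ∀ t ∈ Set.Icc (0:ℝ) T,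
        frobNorm (h x y θ t) ≤ C * Real.exp (a * Real.sqrt (x ^ 2 + y ^ 2))) →
      ∀ θ : ℝ, frobNorm (h 0 0 θ T)
        ≤ A * Real.exp (2 * α * T) * Real.exp (-0.01 * T) := by
  refine ⟨2000, by norm_num, ?_⟩
  intro T hT α hα A hA h _ hc hs hper heat hmean hini hgr θ
  obtain ⟨a, C, ha, hC, hgr⟩ := hgr
  have hT0 : 0 < T := by linarith
  have key := aux_frob (h 0 0 θ T)
    (4 * A * Real.exp (α * 40) * Real.exp ((α ^ 2 + α / 20 - 2 / 9) * T)) (by positivity)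
    (fun p q => aux_scalar hT0 hα.1 hA ha hC (fun x y θ t => h x y θ t p q) (hc p q) (hs p q)
      (fun x y θ t => by rw [hper]) (heat p q) (hmean p q)
      (fun x y θ => (aux_entry _ p q).trans (hini x y θ))
      (fun x y θ t ht => (aux_entry _ p q).trans (hgr x y θ t ht)) θ)
  refine key.trans ?_
  have h12 : (12:ℝ) ≤ Real.exp 11 := by linarith [Real.add_one_le_exp (11:ℝ)]
  obtain ⟨hα0, hα1⟩ := hα
  have e : 3 * (4 * A * Real.exp (α * 40) * Real.exp ((α ^ 2 + α / 20 - 2 / 9) * T))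
      ≤ A * (Real.exp 11 * (Real.exp (α * 40) * Real.exp ((α ^ 2 + α / 20 - 2 / 9) * T))) := by
    have : 0 < A * (Real.exp (α * 40) * Real.exp ((α ^ 2 + α / 20 - 2 / 9) * T)) := by positivity
    nlinarith
  refine e.trans ?_
  rw [mul_assoc, ← Real.exp_add, ← Real.exp_add, ← Real.exp_add]
  apply mul_le_mul_of_nonneg_left _ hA.le
  apply Real.exp_le_exp.2
  norm_num at hα1 ⊢
  have hq : α ^ 2 + α / 20 - 2 / 9 - 2 * α + 1 / 100 ≤ -(7 / 100) := by nlinarith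
  nlinarith
end
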